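/- arXiv:2602.21448 — 2 statements merged into one kernel-verified Lean document; each statement's English description precedes it below -/
import Mathlib

section
/- Let Y : Ω → ℝ be integrable with respect to the product probability measure μ. Then for every subset I ⊆ N, the recursively defined ANOVA projection admits the inclusion–exclusion (Möbius) representation P_I Y = Σ_{J ⊆ I} (−1)^{#(I∖J)} A_J Y, μ-almost everywhere. -/
open MeasureTheory

/-- The marginal `A_J Y`: integrate out the coordinates not in `J`,
i.e. `(A_J Y)(x) = ∫ Y(z) dμ_{N∖J}(z)` with `z_i = x_i` for `i ∈ J`. -/
noncomputable def margA {M : ℕ} {Ω : Fin M → Type*} [∀ i, MeasurableSpace (Ω i)]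
    (μ : ∀ i, Measure (Ω i)) (J : Finset (Fin M)) (Y : (∀ i, Ω i) → ℝ) :
    (∀ i, Ω i) → ℝ :=
  fun x => ∫ z, Y (fun i => if i ∈ J then x i else z i) ∂(Measure.pi μ)

/-- The ANOVA projection `P_I Y`, defined recursively by
`P_I Y = A_I Y - ∑_{J ⊊ I} P_J Y` (so that `P_∅ Y = 𝔼_μ[Y]`). -/
noncomputable def anovaP {M : ℕ} {Ω : Fin M → Type*} [∀ i, MeasurableSpace (Ω i)]
    (μ : ∀ i, Measure (Ω i)) (Y : (∀ i, Ω i) → ℝ) (I : Finset (Fin M)) :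
    (∀ i, Ω i) → ℝ :=
  margA μ I Y - ∑ J ∈ I.ssubsets.attach, anovaP μ Y J.1
termination_by I.card
decreasing_by exact Finset.card_lt_card (Finset.mem_ssubsets.mp J.2)

theorem moebius_aux {α : Type*} [DecidableEq α] (f g : Finset α → ℝ)
    (h : ∀ I, g I = ∑ J ∈ I.powerset, f J) (I : Finset α) :
    f I = ∑ J ∈ I.powerset, (-1 : ℝ) ^ (I \ J).card * g J := by
  have key : ∀ K ∈ I.powerset, (∑ J ∈ I.powerset, if K ⊆ J then (-1 : ℝ) ^ (I \ J).card else 0)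
      = if K = I then 1 else 0 := by
    intro K hK
    rw [Finset.mem_powerset] at hK
    rw [← Finset.sum_filter]
    have h1 : (∑ J ∈ I.powerset with K ⊆ J, (-1 : ℝ) ^ (I \ J).card)
        = ∑ L ∈ (I \ K).powerset, (-1 : ℝ) ^ L.card := by
      refine Finset.sum_nbij' (fun J => I \ J) (fun L => I \ L) ?_ ?_ ?_ ?_ ?_
      · intro J hJ
        simp only [Finset.mem_filter, Finset.mem_powerset] at hJ ⊢
        exact Finset.sdiff_subset_sdiff le_rfl hJ.2
      · intro L hL
        simp only [Finset.mem_filter, Finset.mem_powerset] at hL ⊢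
        refine ⟨Finset.sdiff_subset, fun x hx => ?_⟩
        have := @hL x
        simp only [Finset.mem_sdiff] at this ⊢
        exact ⟨hK hx, fun hl => (this hl).2 hx⟩
      · intro J hJ
        simp only [Finset.mem_filter, Finset.mem_powerset] at hJ
        exact Finset.sdiff_sdiff_eq_self hJ.1
      · intro L hL
        simp only [Finset.mem_powerset] at hL
        exact Finset.sdiff_sdiff_eq_self (hL.trans Finset.sdiff_subset)
      · intro J hJ
        rfl
    rw [h1]
    have h2 := congrArg (Int.cast : ℤ → ℝ)
      (Finset.sum_powerset_neg_one_pow_card (x := I \ K))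
    push_cast at h2
    rw [h2]
    have h3 : I \ K = ∅ ↔ K = I := by
      rw [Finset.sdiff_eq_empty_iff_subset]
      exact ⟨fun h => Finset.Subset.antisymm hK h, fun h => h ▸ le_rfl⟩
    simp only [h3]
  have h4 : ∀ J ∈ I.powerset, (-1 : ℝ) ^ (I \ J).card * g J
      = ∑ K ∈ I.powerset, (if K ⊆ J then (-1 : ℝ) ^ (I \ J).card else 0) * f K := by
    intro J hJ
    rw [Finset.mem_powerset] at hJ
    have h5 : J.powerset = I.powerset.filter (fun K => K ⊆ J) := by
      ext K
      simp only [Finset.mem_filter, Finset.mem_powerset]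
      exact ⟨fun h => ⟨h.trans hJ, h⟩, fun h => h.2⟩
    rw [h J, h5, Finset.sum_filter, Finset.mul_sum]
    refine Finset.sum_congr rfl fun K _ => ?_
    split_ifs <;> simp
  rw [Finset.sum_congr rfl h4, Finset.sum_comm]
  simp_rw [← Finset.sum_mul]
  rw [Finset.sum_congr rfl fun K hK => by rw [key K hK]]
  simp

/-- **Möbius / inclusion–exclusion representation of the ANOVA projection.**
If `Y` is integrable w.r.t. the product probability measure, then for every
`I ⊆ N`, `P_I Y = ∑_{J ⊆ I} (-1)^{#(I∖J)} A_J Y` μ-almost everywhere. -/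
theorem anovaP_eq_alternating_sum_margA
    {M : ℕ} (hM : 1 ≤ M) {Ω : Fin M → Type*} [∀ i, MeasurableSpace (Ω i)]
    (μ : ∀ i, Measure (Ω i)) [∀ i, IsProbabilityMeasure (μ i)]
    (Y : (∀ i, Ω i) → ℝ) (hY : Integrable Y (Measure.pi μ))
    (I : Finset (Fin M)) :
    anovaP μ Y I =ᵐ[Measure.pi μ]
      fun x => ∑ J ∈ I.powerset, (-1 : ℝ) ^ (I \ J).card * margA μ J Y x := by
  refine Filter.Eventually.of_forall fun x => ?_
  refine moebius_aux (fun J => anovaP μ Y J x) (fun J => margA μ J Y x) (fun I => ?_) I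
  have h := congrFun (anovaP.eq_1 μ Y I) x
  rw [Finset.sum_attach I.ssubsets (fun J => anovaP μ Y J)] at h
  simp only [Pi.sub_apply, Finset.sum_apply] at h
  have h2 : I.powerset = insert I I.ssubsets := by
    rw [Finset.ssubsets, Finset.insert_erase (Finset.mem_powerset_self I)]
  rw [h2, Finset.sum_insert (by simp [Finset.mem_ssubsets])]
  linarith
end

section
/- Let Y : Ω → ℝ be integrable with respect to the product probability measure μ. For all subsets I, J ⊆ N with I ⊄ J (i.e., there exists i ∈ I with i ∉ J), the marginal of the ANOVA projection vanishes: A_J (P_I Y) = 0 μ-almost everywhere. In particular, for every nonempty I ⊆ N one has ∫_Ω P_I Y dμ = 0. -/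
open MeasureTheory

section aux
variable {M : ℕ} {Ω : Fin M → Type*} [∀ i, MeasurableSpace (Ω i)]
    (μ : ∀ i, Measure (Ω i)) [∀ i, IsProbabilityMeasure (μ i)]

theorem mix_mp (J : Finset (Fin M)) :
    MeasurePreserving (fun p : (∀ i, Ω i) × (∀ i, Ω i) => (fun i => if i ∈ J then p.1 i else p.2 i))
      ((Measure.pi μ).prod (Measure.pi μ)) (Measure.pi μ) := by
  have hm : Measurable (fun p : (∀ i, Ω i) × (∀ i, Ω i) =>
      (fun i => if i ∈ J then p.1 i else p.2 i)) := by
    refine measurable_pi_lambda _ fun i => ?_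
    by_cases h : i ∈ J
    · simp only [h, if_true]; fun_prop
    · simp only [h, if_false]; fun_prop
  refine ⟨hm, ?_⟩
  symm
  refine Measure.pi_eq fun s hs => ?_
  rw [Measure.map_apply hm (MeasurableSet.univ_pi hs)]
  have : (fun p : (∀ i, Ω i) × (∀ i, Ω i) => (fun i => if i ∈ J then p.1 i else p.2 i)) ⁻¹'
      (Set.univ.pi s) = (Set.univ.pi fun i => if i ∈ J then s i else Set.univ) ×ˢ
        (Set.univ.pi fun i => if i ∈ J then Set.univ else s i) := by
    ext p
    simp only [Set.mem_preimage, Set.mem_pi, Set.mem_univ, true_imp_iff, Set.mem_prod]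
    rw [← forall_and]
    refine forall_congr' fun i => ?_
    by_cases h : i ∈ J <;> simp [h]
  rw [this, Measure.prod_prod, Measure.pi_pi, Measure.pi_pi, ← Finset.prod_mul_distrib]
  refine Finset.prod_congr rfl fun i _ => ?_
  by_cases h : i ∈ J <;> simp [h]

theorem mix_int (J : Finset (Fin M)) {f : (∀ i, Ω i) → ℝ} (hf : Integrable f (Measure.pi μ)) :
    Integrable (fun p : (∀ i, Ω i) × (∀ i, Ω i) => f (fun i => if i ∈ J then p.1 i else p.2 i))
      ((Measure.pi μ).prod (Measure.pi μ)) :=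
  (mix_mp μ J).integrable_comp_of_integrable hf

theorem margA_int (J : Finset (Fin M)) {f : (∀ i, Ω i) → ℝ} (hf : Integrable f (Measure.pi μ)) :
    Integrable (margA μ J f) (Measure.pi μ) :=
  (mix_int μ J hf).integral_prod_left

theorem slice_int (J : Finset (Fin M)) {f : (∀ i, Ω i) → ℝ} (hf : Integrable f (Measure.pi μ)) :
    ∀ᵐ x ∂(Measure.pi μ),
      Integrable (fun z => f (fun i => if i ∈ J then x i else z i)) (Measure.pi μ) :=
  (mix_int μ J hf).prod_right_ae

theorem margA_sub (J : Finset (Fin M)) {f g : (∀ i, Ω i) → ℝ} (hf : Integrable f (Measure.pi μ))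
    (hg : Integrable g (Measure.pi μ)) :
    margA μ J (f - g) =ᵐ[Measure.pi μ] margA μ J f - margA μ J g := by
  filter_upwards [slice_int μ J hf, slice_int μ J hg] with x h1 h2
  exact integral_sub h1 h2

theorem margA_sum (J : Finset (Fin M)) {ι : Type*} (s : Finset ι) {f : ι → (∀ i, Ω i) → ℝ}
    (hf : ∀ k ∈ s, Integrable (f k) (Measure.pi μ)) :
    margA μ J (∑ k ∈ s, f k) =ᵐ[Measure.pi μ] ∑ k ∈ s, margA μ J (f k) := by
  have : ∀ᵐ x ∂(Measure.pi μ), ∀ k ∈ s,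
      Integrable (fun z => f k (fun i => if i ∈ J then x i else z i)) (Measure.pi μ) :=
    (ae_ball_iff s.countable_toSet).2 fun k hk => slice_int μ J (hf k hk)
  filter_upwards [this] with x hx
  simp only [margA, Finset.sum_apply]
  exact integral_finsetSum s hx

theorem margA_margA (J K : Finset (Fin M)) {f : (∀ i, Ω i) → ℝ}
    (hf : Integrable f (Measure.pi μ)) :
    margA μ J (margA μ K f) =ᵐ[Measure.pi μ] margA μ (K ∩ J) f := by
  filter_upwards [slice_int μ (K ∩ J) hf] with x hx
  have h1 := mix_int μ K hx
  have h2 := integral_prod _ h1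
  have h3 := (mix_mp μ K).map_eq
  have h4 := integral_map (mix_mp μ K).measurable.aemeasurable
    (f := fun z => f (fun i => if i ∈ K ∩ J then x i else z i))
    (by rw [h3]; exact hx.aestronglyMeasurable)
  rw [h3] at h4
  simp only [margA]
  rw [h4, h2]
  refine integral_congr_ae (Filter.Eventually.of_forall fun z => ?_)
  refine integral_congr_ae (Filter.Eventually.of_forall fun w => ?_)
  dsimp only
  congr 1
  ext i
  by_cases hK : i ∈ K <;> by_cases hJ : i ∈ J <;> simp [hK, hJ]

theorem anovaP_eq (Y : (∀ i, Ω i) → ℝ) (I : Finset (Fin M)) :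
    anovaP μ Y I = margA μ I Y - ∑ J ∈ I.ssubsets, anovaP μ Y J := by
  rw [anovaP, Finset.sum_attach I.ssubsets (fun J => anovaP μ Y J)]

theorem anovaP_sum (Y : (∀ i, Ω i) → ℝ) (I : Finset (Fin M)) :
    ∑ J ∈ I.powerset, anovaP μ Y J = margA μ I Y := by
  have : I.powerset = insert I I.ssubsets := by
    ext K
    simp only [Finset.mem_powerset, Finset.mem_insert, Finset.mem_ssubsets]
    exact le_iff_eq_or_lt
  rw [this, Finset.sum_insert (by simp), anovaP_eq μ Y I]
  abel

theorem anovaP_int {Y : (∀ i, Ω i) → ℝ} (hY : Integrable Y (Measure.pi μ))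
    (I : Finset (Fin M)) : Integrable (anovaP μ Y I) (Measure.pi μ) := by
  induction I using Finset.strongInduction with
  | H I ih =>
    rw [anovaP_eq]
    exact (margA_int μ I hY).sub
      (integrable_finsetSum' _ fun K hK => ih K (Finset.mem_ssubsets.1 hK))

theorem anovaP_dep (Y : (∀ i, Ω i) → ℝ) (I : Finset (Fin M)) :
    ∀ x y : (∀ i, Ω i), (∀ i ∈ I, x i = y i) → anovaP μ Y I x = anovaP μ Y I y := by
  induction I using Finset.strongInduction with
  | H I ih =>
    intro x y h
    rw [anovaP_eq]
    simp only [Pi.sub_apply, Finset.sum_apply]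
    congr 1
    · simp only [margA]
      congr 1
      ext z
      congr 1
      ext i
      by_cases hi : i ∈ I <;> simp [hi, h]
    · exact Finset.sum_congr rfl fun K hK => ih K (Finset.mem_ssubsets.1 hK) x y
        fun i hi => h i ((Finset.mem_ssubsets.1 hK).1 hi)

theorem margA_anovaP_self (Y : (∀ i, Ω i) → ℝ) {I J : Finset (Fin M)} (h : I ⊆ J) :
    margA μ J (anovaP μ Y I) = anovaP μ Y I := by
  ext x
  have : ∀ z : (∀ i, Ω i), anovaP μ Y I (fun i => if i ∈ J then x i else z i)
      = anovaP μ Y I x := fun z => anovaP_dep μ Y I _ _ fun i hi => by simp [h hi]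
  simp [margA, this]

theorem margA_anovaP_aux {Y : (∀ i, Ω i) → ℝ} (hY : Integrable Y (Measure.pi μ))
    (I J : Finset (Fin M)) : ¬ I ⊆ J →
    margA μ J (anovaP μ Y I) =ᵐ[Measure.pi μ] fun _ => (0 : ℝ) := by
  induction I using Finset.strongInduction with
  | H I ih =>
    intro hIJ
    have hint : ∀ K ∈ I.ssubsets, Integrable (anovaP μ Y K) (Measure.pi μ) :=
      fun K _ => anovaP_int μ hY K
    have e1 := margA_sub μ J (margA_int μ I hY) (integrable_finsetSum' _ hint)
    rw [← anovaP_eq] at e1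
    have e2 := margA_sum μ J _ hint
    have e3 := margA_margA μ J I hY
    have e4 : ∀ᵐ x ∂(Measure.pi μ), ∀ K ∈ I.ssubsets,
        margA μ J (anovaP μ Y K) x = if K ⊆ J then anovaP μ Y K x else 0 := by
      refine (ae_ball_iff I.ssubsets.countable_toSet).2 fun K hK => ?_
      by_cases h : K ⊆ J
      · simp [h, margA_anovaP_self μ Y h]
      · filter_upwards [ih K (Finset.mem_ssubsets.1 hK) h] with x hx
        simp [h, hx]
    filter_upwards [e1, e2, e3, e4] with x h1 h2 h3 h4
    rw [h1, Pi.sub_apply, h2, h3, Finset.sum_apply, Finset.sum_congr rfl h4,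
      ← Finset.sum_filter]
    have : I.ssubsets.filter (fun K => K ⊆ J) = (I ∩ J).powerset := by
      ext K
      simp only [Finset.mem_filter, Finset.mem_ssubsets, Finset.mem_powerset,
        Finset.subset_inter_iff]
      refine ⟨fun h => ⟨h.1.1, h.2⟩, fun h => ⟨⟨h.1, fun h' => hIJ (h'.trans h.2)⟩, h.2⟩⟩
    rw [this, ← anovaP_sum, Finset.sum_apply, sub_self]

end aux

/-- **Vanishing marginals of ANOVA projections.** If `Y` is integrable w.r.t. the
product probability measure, then for all `I, J ⊆ N` with `I ⊄ J`,
`A_J (P_I Y) = 0` μ-a.e.; in particular `∫ P_I Y dμ = 0` for every nonempty `I`. -/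
theorem margA_anovaP_eq_zero
    {M : ℕ} (hM : 1 ≤ M) {Ω : Fin M → Type*} [∀ i, MeasurableSpace (Ω i)]
    (μ : ∀ i, Measure (Ω i)) [∀ i, IsProbabilityMeasure (μ i)]
    (Y : (∀ i, Ω i) → ℝ) (hY : Integrable Y (Measure.pi μ)) :
    (∀ I J : Finset (Fin M), ¬ I ⊆ J →
        margA μ J (anovaP μ Y I) =ᵐ[Measure.pi μ] fun _ => (0 : ℝ))
    ∧ (∀ I : Finset (Fin M), I ≠ ∅ →
        ∫ x, anovaP μ Y I x ∂(Measure.pi μ) = 0) := by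
  refine ⟨fun I J h => margA_anovaP_aux μ hY I J h, fun I hI => ?_⟩
  have h := margA_anovaP_aux μ hY I ∅ (by simpa using hI)
  obtain ⟨x, hx⟩ := h.exists
  simpa [margA] using hx
end
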